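/- arXiv:1107.2719 — 2 statements merged into one kernel-verified Lean document; each statement's English description precedes it below -/
import Mathlib

section
/- A positive percentage of subsets of {0,1,…,n−1} are sum-dominant: the liminf as n → ∞ of (number of subsets A ⊆ {0,1,…,n−1} with |A+A| > |A−A|) divided by 2^n is at least 2·10^{−7}. -/
open Finset Filter
open scoped Pointwise

/-- The number of MSTD (sum-dominant) subsets of `{0, 1, …, n-1}`. -/
noncomputable def mstdCount (n : ℕ) : ℕ :=
  ((Finset.Icc (0 : ℤ) ((n : ℤ) - 1)).powerset.filter
    fun A => (A - A).card < (A + A).card).card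

theorem pairs_count (k : ℤ) (I : Finset ℤ) : ∀ S : Finset ℤ,
    (∀ i ∈ I, i ∈ S ∧ k - i ∈ S ∧ 2 * i < k) →
    (S.powerset.filter fun M => ∀ i ∈ I, ¬ (i ∈ M ∧ k - i ∈ M)).card * 4 ^ I.card
      ≤ 3 ^ I.card * 2 ^ S.card := by
  induction I using Finset.induction_on with
  | empty => intro S _; simp
  | insert a I ha ih =>
    intro S hS
    obtain ⟨haS, hbS, hab⟩ := hS a (Finset.mem_insert_self _ _)
    set S' := (S.erase a).erase (k - a) with hS'
    have hb' : k - a ∈ S.erase a := Finset.mem_erase.2 ⟨by omega, hbS⟩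
    have hc1 : S'.card + 2 = S.card := by
      have h1 := Finset.card_erase_add_one haS
      have h2 := Finset.card_erase_add_one hb'
      rw [← hS'] at h2
      omega
    have h := ih S' (by
      intro i hi
      obtain ⟨h1, h2, h3⟩ := hS i (Finset.mem_insert_of_mem hi)
      have hne : i ≠ a := fun h => ha (h ▸ hi)
      simp only [hS', Finset.mem_erase]
      refine ⟨⟨by omega, hne, h1⟩, ⟨by omega, by omega, h2⟩, h3⟩)
    set F := (S.powerset.filter fun M => ∀ i ∈ insert a I, ¬ (i ∈ M ∧ k - i ∈ M)) with hF
    set G := (S'.powerset.filter fun M => ∀ i ∈ I, ¬ (i ∈ M ∧ k - i ∈ M)) with hG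
    have key : F ⊆ G ∪ G.image (insert a) ∪ G.image (insert (k - a)) := by
      intro M hM
      simp only [hF, Finset.mem_filter, Finset.mem_powerset] at hM
      obtain ⟨hMS, hM⟩ := hM
      have hMa := hM a (Finset.mem_insert_self _ _)
      have hmem : (M.erase a).erase (k - a) ∈ G := by
        simp only [hG, Finset.mem_filter, Finset.mem_powerset]
        refine ⟨Finset.erase_subset_erase _ (Finset.erase_subset_erase _ hMS), ?_⟩
        intro i hi h
        simp only [Finset.mem_erase] at h
        exact hM i (Finset.mem_insert_of_mem hi) ⟨h.1.2.2, h.2.2.2⟩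
      simp only [Finset.mem_union, Finset.mem_image]
      by_cases h1 : a ∈ M
      · have h2 : k - a ∉ M := fun h2 => hMa ⟨h1, h2⟩
        refine Or.inl (Or.inr ⟨_, hmem, ?_⟩)
        rw [Finset.erase_eq_of_notMem (a := k - a) (fun h => h2 (Finset.mem_of_mem_erase h)),
          Finset.insert_erase h1]
      · rw [Finset.erase_eq_of_notMem h1] at hmem
        by_cases h2 : k - a ∈ M
        · exact Or.inr ⟨_, hmem, Finset.insert_erase h2⟩
        · rw [Finset.erase_eq_of_notMem h2] at hmem
          exact Or.inl (Or.inl hmem)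
    have hFG : F.card ≤ 3 * G.card := by
      have e1 := Finset.card_le_card key
      have e2 := Finset.card_union_le (G ∪ G.image (insert a)) (G.image (insert (k - a)))
      have e3 := Finset.card_union_le G (G.image (insert a))
      have e4 : (G.image (insert a)).card ≤ G.card := Finset.card_image_le
      have e5 : (G.image (insert (k - a))).card ≤ G.card := Finset.card_image_le
      omega
    rw [Finset.card_insert_of_notMem ha, ← hc1]
    calc F.card * 4 ^ (I.card + 1) ≤ 3 * G.card * 4 ^ (I.card + 1) := by gcongr
      _ = 12 * (G.card * 4 ^ I.card) := by ring
      _ ≤ 12 * (3 ^ I.card * 2 ^ S'.card) := by gcongr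
      _ = _ := by ring

theorem bad_count (k : ℤ) (S T I : Finset ℤ) (hT : T ⊆ S)
    (hI : ∀ i ∈ I, (i ∈ S ∧ i ∉ T) ∧ (k - i ∈ S ∧ k - i ∉ T) ∧ 2 * i < k)
    (B : Finset (Finset ℤ)) (hB : ∀ M ∈ B, M ⊆ S ∧ (∀ t ∈ T, t ∉ M) ∧
      ∀ i ∈ I, ¬ (i ∈ M ∧ k - i ∈ M)) :
    (B.card : ℝ) ≤ 2 ^ S.card * ((1 / 2) ^ T.card * (3 / 4) ^ I.card) := by
  have h := pairs_count k I (S \ T) (by simpa [Finset.mem_sdiff] using hI)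
  have hsub : B ⊆ ((S \ T).powerset.filter fun M => ∀ i ∈ I, ¬ (i ∈ M ∧ k - i ∈ M)) := by
    intro M hM
    obtain ⟨h1, h2, h3⟩ := hB M hM
    simp only [Finset.mem_filter, Finset.mem_powerset]
    refine ⟨fun x hx => Finset.mem_sdiff.2 ⟨h1 hx, fun ht => h2 x ht hx⟩, h3⟩
  have hc := Finset.card_le_card hsub
  have hcard : (S \ T).card + T.card = S.card := Finset.card_sdiff_add_card_eq_card hT
  have h4 : (B.card : ℝ) * 4 ^ I.card ≤ 3 ^ I.card * 2 ^ (S \ T).card := by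
    have := (Nat.mul_le_mul_right (4 ^ I.card) hc).trans h
    exact_mod_cast this
  rw [← hcard, pow_add, div_pow, div_pow, one_pow]
  have : (2:ℝ) ^ (S \ T).card * 2 ^ T.card * (1 / 2 ^ T.card * (3 ^ I.card / 4 ^ I.card))
      = 3 ^ I.card * 2 ^ (S \ T).card / 4 ^ I.card := by
    field_simp
  rw [this, le_div_iff₀ (by positivity)]
  exact h4

theorem geom_half (K : ℕ) : ∑ m ∈ Finset.range K, ((3:ℝ) / 4) ^ (m / 2) ≤ 8 := by
  have h : ∀ N : ℕ, ∑ m ∈ Finset.range (2 * N), ((3:ℝ) / 4) ^ (m / 2) = 8 - 8 * (3 / 4) ^ N := by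
    intro N
    induction N with
    | zero => simp
    | succ N ih =>
      rw [show 2 * (N + 1) = 2 * N + 1 + 1 by ring, Finset.sum_range_succ, Finset.sum_range_succ,
        ih, show 2 * N / 2 = N by omega, show (2 * N + 1) / 2 = N by omega]
      ring
  calc _ ≤ ∑ m ∈ Finset.range (2 * K), ((3:ℝ) / 4) ^ (m / 2) :=
        Finset.sum_le_sum_of_subset_of_nonneg
          (Finset.range_subset_range.2 (by omega)) (fun _ _ _ => by positivity)
    _ ≤ 8 := by
      rw [h]
      have : (0:ℝ) ≤ (3 / 4) ^ K := by positivity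
      linarith

/-- Left fringe. -/
def fringeL : Finset ℤ := {0, 2, 3, 7, 8, 9, 10}

/-- Right fringe, measured from the right end. -/
def fringeR : Finset ℤ := {0, 1, 2, 5, 7, 8, 9, 10}

/-- The middle part. -/
noncomputable def mid (n : ℕ) : Finset ℤ := Finset.Icc 11 ((n : ℤ) - 12)

/-- The set with the prescribed fringes and middle part `M`. -/
noncomputable def full (n : ℕ) (M : Finset ℤ) : Finset ℤ :=
  fringeL ∪ M ∪ fringeR.image (fun x => (n : ℤ) - 1 - x)

/-- The middle parts for which `k` is not a sum. -/
noncomputable def bad (n : ℕ) (k : ℤ) : Finset (Finset ℤ) :=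
  (mid n).powerset.filter fun M => k ∉ full n M + full n M

theorem mem_L {x : ℤ} : x ∈ fringeL ↔
    x = 0 ∨ x = 2 ∨ x = 3 ∨ x = 7 ∨ x = 8 ∨ x = 9 ∨ x = 10 := by
  simp [fringeL]

theorem mem_R {x : ℤ} : x ∈ fringeR ↔
    x = 0 ∨ x = 1 ∨ x = 2 ∨ x = 5 ∨ x = 7 ∨ x = 8 ∨ x = 9 ∨ x = 10 := by
  simp [fringeR]

theorem mem_full {n : ℕ} {M : Finset ℤ} {x : ℤ} :
    x ∈ full n M ↔ x ∈ fringeL ∨ x ∈ M ∨ (n : ℤ) - 1 - x ∈ fringeR := by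
  simp only [full, Finset.mem_union, Finset.mem_image, or_assoc]
  refine or_congr Iff.rfl (or_congr Iff.rfl ⟨?_, fun h => ⟨_, h, by ring⟩⟩)
  rintro ⟨y, hy, rfl⟩
  simpa using hy

theorem mem_mid {n : ℕ} {x : ℤ} : x ∈ mid n ↔ 11 ≤ x ∧ x ≤ (n : ℤ) - 12 := by
  simp [mid]

theorem bad_spec {n : ℕ} {k : ℤ} {M : Finset ℤ} (h : M ∈ bad n k) :
    M ⊆ mid n ∧ ∀ x ∈ full n M, k - x ∉ full n M := by
  simp only [bad, Finset.mem_filter, Finset.mem_powerset] at h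
  refine ⟨h.1, fun x hx hy => h.2 ?_⟩
  exact Finset.mem_add.2 ⟨x, hx, k - x, hy, by ring⟩

theorem bad_pair {n : ℕ} {k i : ℤ} {M : Finset ℤ} (h : M ∈ bad n k) :
    ¬ (i ∈ M ∧ k - i ∈ M) := fun hh =>
  (bad_spec h).2 i (mem_full.2 (Or.inr (Or.inl hh.1))) (mem_full.2 (Or.inr (Or.inl hh.2)))

theorem bad_low (n m : ℕ) (hm : m + 33 ≤ n) :
    ((bad n (21 + m)).card : ℝ) ≤ 2 ^ (mid n).card * ((1 / 2) ^ 7 * (3 / 4) ^ (m / 2)) := by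
  have hT : (fringeL.image (fun x => (21 + m : ℤ) - x)).card = 7 := by
    rw [Finset.card_image_of_injective _ (fun x y h => by simpa using h)]; rfl
  have hI : (Finset.Ico (11 : ℤ) (11 + (m / 2 : ℕ))).card = m / 2 := by rw [Int.card_Ico]; omega
  rw [← hT]
  conv_rhs => rw [← hI]
  apply bad_count (21 + m)
  · intro x hx
    simp only [Finset.mem_image, mem_L] at hx
    rw [mem_mid]
    omega
  · intro i hi
    simp only [Finset.mem_Ico] at hi
    simp only [Finset.mem_image, mem_L, mem_mid]
    omega
  · intro M hM
    refine ⟨(bad_spec hM).1, ?_, fun i _ => bad_pair hM⟩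
    intro t ht htM
    obtain ⟨x, hx, rfl⟩ := Finset.mem_image.1 ht
    exact (bad_spec hM).2 x (mem_full.2 (Or.inl hx)) (mem_full.2 (Or.inr (Or.inl htM)))

theorem bad_high (n m : ℕ) (hm : m + 33 ≤ n) :
    ((bad n (2 * n - 23 - m)).card : ℝ)
      ≤ 2 ^ (mid n).card * ((1 / 2) ^ 8 * (3 / 4) ^ (m / 2)) := by
  have hT : (fringeR.image (fun x => (2 * n - 23 - m : ℤ) - (n - 1 - x))).card = 8 := by
    rw [Finset.card_image_of_injective _ (fun x y h => by simpa using h)]; rfl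
  have hI : (Finset.Ico ((n : ℤ) - 11 - m) (n - 11 - m + (m / 2 : ℕ))).card = m / 2 := by rw [Int.card_Ico]; omega
  rw [← hT]
  conv_rhs => rw [← hI]
  apply bad_count (2 * n - 23 - m)
  · intro x hx
    simp only [Finset.mem_image, mem_R] at hx
    rw [mem_mid]
    omega
  · intro i hi
    simp only [Finset.mem_Ico] at hi
    simp only [Finset.mem_image, mem_R, mem_mid]
    omega
  · intro M hM
    refine ⟨(bad_spec hM).1, ?_, fun i _ => bad_pair hM⟩
    intro t ht htM
    obtain ⟨x, hx, rfl⟩ := Finset.mem_image.1 ht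
    refine (bad_spec hM).2 (n - 1 - x) (mem_full.2 (Or.inr (Or.inr ?_)))
      (mem_full.2 (Or.inr (Or.inl htM)))
    simpa using hx

theorem bad_mid (n m : ℕ) (hn : 200 ≤ n) (hm : m < 22) :
    ((bad n (n - 11 + m)).card : ℝ) ≤ 2 ^ (mid n).card * (3 / 4) ^ (n / 2 - 50) := by
  have hI : (Finset.Ico (22 : ℤ) (22 + (n / 2 - 50 : ℕ))).card = n / 2 - 50 := by simp
  have h := bad_count (n - 11 + m) (mid n) ∅ (Finset.Ico (22 : ℤ) (22 + (n / 2 - 50 : ℕ)))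
    (by simp) (by
      intro i hi
      simp only [Finset.mem_Ico] at hi
      simp only [Finset.notMem_empty, not_false_eq_true, and_true, mem_mid]
      omega) (bad n (n - 11 + m))
    (fun M hM => ⟨(bad_spec hM).1, by simp, fun i _ => bad_pair hM⟩)
  rw [hI] at h
  simpa using h

theorem full_diff {n : ℕ} (hn : 200 ≤ n) {M : Finset ℤ} (hM : M ⊆ mid n) :
    (full n M - full n M).card ≤ 2 * n - 3 := by
  have hsub : full n M - full n M ⊆
      ((Finset.Icc (-(n - 1) : ℤ) (n - 1)).erase (n - 7)).erase (-(n - 7)) := by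
    intro d hd
    obtain ⟨x, hx, y, hy, rfl⟩ := Finset.mem_sub.1 hd
    have hMx : x ∈ M → 11 ≤ x ∧ x ≤ (n : ℤ) - 12 := fun h => mem_mid.1 (hM h)
    have hMy : y ∈ M → 11 ≤ y ∧ y ≤ (n : ℤ) - 12 := fun h => mem_mid.1 (hM h)
    rw [mem_full, mem_L, mem_R] at hx hy
    simp only [Finset.mem_erase, Finset.mem_Icc]
    have hx' : (x = 0 ∨ x = 2 ∨ x = 3 ∨ x = 7 ∨ x = 8 ∨ x = 9 ∨ x = 10) ∨
      (11 ≤ x ∧ x ≤ (n : ℤ) - 12) ∨ _ := hx.imp_right (Or.imp_left hMx)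
    have hy' : (y = 0 ∨ y = 2 ∨ y = 3 ∨ y = 7 ∨ y = 8 ∨ y = 9 ∨ y = 10) ∨
      (11 ≤ y ∧ y ≤ (n : ℤ) - 12) ∨ _ := hy.imp_right (Or.imp_left hMy)
    clear hx hy hMx hMy hd
    rcases hx' with hx | hx | hx <;> rcases hy' with hy | hy | hy <;> omega
  refine (Finset.card_le_card hsub).trans ?_
  rw [Finset.card_erase_of_mem, Finset.card_erase_of_mem, Int.card_Icc]
  · omega
  · simp only [Finset.mem_Icc]; omega
  · simp only [Finset.mem_erase, Finset.mem_Icc]; omega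

theorem LL (k : ℤ) (h0 : 0 ≤ k) (h1 : k ≠ 1) (h2 : k ≤ 20) : k ∈ fringeL + fringeL := by
  interval_cases k <;> first | exact absurd rfl h1 | decide

theorem RR (k : ℤ) (h0 : 0 ≤ k) (h2 : k ≤ 20) : k ∈ fringeR + fringeR := by
  interval_cases k <;> decide

theorem full_sum {n : ℕ} (hn : 200 ≤ n) {M : Finset ℤ}
    (h : ∀ k : ℤ, 21 ≤ k → k ≤ 2 * n - 23 → k ∈ full n M + full n M) :
    2 * n - 2 ≤ (full n M + full n M).card := by
  have hsub : (Finset.Icc (0 : ℤ) (2 * n - 2)).erase 1 ⊆ full n M + full n M := by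
    intro k hk
    simp only [Finset.mem_erase, Finset.mem_Icc] at hk
    by_cases h1 : k ≤ 20
    · have hL : fringeL ⊆ full n M := fun x hx => mem_full.2 (Or.inl hx)
      exact Finset.add_subset_add hL hL (LL k hk.2.1 hk.1 h1)
    by_cases h2 : k ≤ 2 * n - 23
    · exact h k (by omega) h2
    obtain ⟨x, hx, y, hy, hxy⟩ := Finset.mem_add.1 (RR (2 * n - 2 - k) (by omega) (by omega))
    refine Finset.mem_add.2 ⟨n - 1 - x, mem_full.2 (Or.inr (Or.inr ?_)), n - 1 - y,
      mem_full.2 (Or.inr (Or.inr ?_)), by omega⟩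
    · simpa using hx
    · simpa using hy
  refine le_trans ?_ (Finset.card_le_card hsub)
  rw [Finset.card_erase_of_mem, Int.card_Icc]
  · omega
  · simp only [Finset.mem_Icc]; omega

theorem full_inj {n : ℕ} {M M' : Finset ℤ} (hM : M ⊆ mid n)
    (h : full n M = full n M') : M ⊆ M' := by
  intro x hx
  have hx1 := mem_mid.1 (hM hx)
  have : x ∈ full n M' := h ▸ mem_full.2 (Or.inr (Or.inl hx))
  rw [mem_full, mem_L, mem_R] at this
  rcases this with h | h | h
  · omega
  · exact h
  · omega

/-- All bad middle parts. -/
noncomputable def allBad (n : ℕ) : Finset (Finset ℤ) :=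
  ((Finset.range (n - 32)).biUnion fun m => bad n (21 + m)) ∪
  ((Finset.range (n - 32)).biUnion fun m => bad n (2 * n - 23 - m)) ∪
  ((Finset.range 22).biUnion fun m => bad n (n - 11 + m))

theorem allBad_card {n : ℕ} (hn : 200 ≤ n) :
    ((allBad n).card : ℝ) ≤ 2 ^ (mid n).card * (24 / 256 + 22 * (3 / 4) ^ (n / 2 - 50)) := by
  have e1 : (((Finset.range (n - 32)).biUnion fun m : ℕ => bad n (21 + m)).card : ℝ)
      ≤ 2 ^ (mid n).card * (8 / 128) := by
    calc _ ≤ ∑ m ∈ Finset.range (n - 32), ((bad n (21 + m)).card : ℝ) := by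
          exact_mod_cast Finset.card_biUnion_le
      _ ≤ ∑ m ∈ Finset.range (n - 32),
          2 ^ (mid n).card * ((1 / 2) ^ 7 * ((3 : ℝ) / 4) ^ (m / 2)) :=
          Finset.sum_le_sum fun m hm => bad_low n m (by have := Finset.mem_range.1 hm; omega)
      _ = 2 ^ (mid n).card *
          ((1 / 2) ^ 7 * ∑ m ∈ Finset.range (n - 32), ((3 : ℝ) / 4) ^ (m / 2)) := by
          rw [Finset.mul_sum, Finset.mul_sum]
      _ ≤ 2 ^ (mid n).card * ((1 / 2) ^ 7 * 8) := by gcongr; exact geom_half _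
      _ = _ := by norm_num
  have e2 : (((Finset.range (n - 32)).biUnion fun m : ℕ => bad n (2 * n - 23 - m)).card : ℝ)
      ≤ 2 ^ (mid n).card * (8 / 256) := by
    calc _ ≤ ∑ m ∈ Finset.range (n - 32), ((bad n (2 * n - 23 - m)).card : ℝ) := by
          exact_mod_cast Finset.card_biUnion_le
      _ ≤ ∑ m ∈ Finset.range (n - 32),
          2 ^ (mid n).card * ((1 / 2) ^ 8 * ((3 : ℝ) / 4) ^ (m / 2)) :=
          Finset.sum_le_sum fun m hm => bad_high n m (by have := Finset.mem_range.1 hm; omega)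
      _ = 2 ^ (mid n).card *
          ((1 / 2) ^ 8 * ∑ m ∈ Finset.range (n - 32), ((3 : ℝ) / 4) ^ (m / 2)) := by
          rw [Finset.mul_sum, Finset.mul_sum]
      _ ≤ 2 ^ (mid n).card * ((1 / 2) ^ 8 * 8) := by gcongr; exact geom_half _
      _ = _ := by norm_num
  have e3 : (((Finset.range 22).biUnion fun m : ℕ => bad n (n - 11 + m)).card : ℝ)
      ≤ 22 * (2 ^ (mid n).card * (3 / 4) ^ (n / 2 - 50)) := by
    calc _ ≤ ∑ m ∈ Finset.range 22, ((bad n (n - 11 + m)).card : ℝ) := by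
          exact_mod_cast Finset.card_biUnion_le
      _ ≤ ∑ m ∈ Finset.range 22, 2 ^ (mid n).card * ((3 : ℝ) / 4) ^ (n / 2 - 50) :=
          Finset.sum_le_sum fun m hm => bad_mid n m hn (Finset.mem_range.1 hm)
      _ = _ := by rw [Finset.sum_const, Finset.card_range, nsmul_eq_mul]; norm_num
  have e4 : ((allBad n).card : ℝ) ≤ _ := Nat.cast_le.2 ((Finset.card_union_le _ _).trans
    (Nat.add_le_add_right (Finset.card_union_le _ _) _))
  push_cast at e4
  linarith

theorem mstd_lower {n : ℕ} (hn : 200 ≤ n) :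
    2 ^ (mid n).card ≤ mstdCount n + (allBad n).card := by
  have h1 : ((mid n).powerset \ allBad n).card ≤ mstdCount n := by
    apply Finset.card_le_card_of_injOn (full n)
    · intro M hM
      have hM' := Finset.mem_sdiff.1 (Finset.mem_coe.1 hM)
      have hMs := Finset.mem_powerset.1 hM'.1
      have hgood : ∀ k : ℤ, 21 ≤ k → k ≤ 2 * n - 23 → k ∈ full n M + full n M := by
        intro k hk1 hk2
        by_contra hk
        have hb : M ∈ bad n k := by
          simp only [bad, Finset.mem_filter]
          exact ⟨hM'.1, hk⟩
        apply hM'.2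
        simp only [allBad, Finset.mem_union, Finset.mem_biUnion, Finset.mem_range]
        by_cases c1 : k ≤ n - 12
        · refine Or.inl (Or.inl ⟨(k - 21).toNat, by omega, ?_⟩)
          rwa [show (21 + ((k - 21).toNat : ℤ)) = k by omega]
        by_cases c2 : n + 10 ≤ k
        · refine Or.inl (Or.inr ⟨(2 * n - 23 - k).toNat, by omega, ?_⟩)
          rwa [show (2 * (n : ℤ) - 23 - ((2 * n - 23 - k).toNat : ℤ)) = k by omega]
        · refine Or.inr ⟨(k - (n - 11)).toNat, by omega, ?_⟩
          rwa [show ((n : ℤ) - 11 + ((k - (n - 11)).toNat : ℤ)) = k by omega]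
      have hs := full_sum hn hgood
      have hd := full_diff hn hMs
      simp only [Finset.coe_filter, Set.mem_ofPred_eq, Finset.mem_powerset]
      refine ⟨?_, by omega⟩
      intro x hx
      rw [mem_full, mem_L, mem_R] at hx
      rw [Finset.mem_Icc]
      rcases hx with h | h | h
      · omega
      · have := mem_mid.1 (hMs h); omega
      · omega
    · intro M hM M' hM' h
      have a1 := Finset.mem_powerset.1 (Finset.mem_sdiff.1 (Finset.mem_coe.1 hM)).1
      have a2 := Finset.mem_powerset.1 (Finset.mem_sdiff.1 (Finset.mem_coe.1 hM')).1
      exact Finset.Subset.antisymm (full_inj a1 h) (full_inj a2 h.symm)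
  have h2 := Finset.le_card_sdiff (allBad n) (mid n).powerset
  rw [Finset.card_powerset] at h2
  omega

theorem mstd_le (n : ℕ) : mstdCount n ≤ 2 ^ n := by
  unfold mstdCount
  refine (Finset.card_filter_le _ _).trans ?_
  rw [Finset.card_powerset, Int.card_Icc]
  simp

/-- A positive percentage of subsets of `{0,…,n-1}` are sum-dominant: the liminf of the
proportion of sum-dominant subsets is at least `2·10⁻⁷` (Martin–O'Bryant). -/
theorem positive_percentage_mstd :
    (2 : ℝ) / 10 ^ 7 ≤
      Filter.liminf (fun n : ℕ => (mstdCount n : ℝ) / 2 ^ n) Filter.atTop := by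
  apply Filter.le_liminf_of_le
  · apply Filter.IsBoundedUnder.isCoboundedUnder_ge
    refine ⟨1, Filter.eventually_map.2 (Filter.Eventually.of_forall fun n => ?_)⟩
    show (mstdCount n : ℝ) / 2 ^ n ≤ 1
    rw [div_le_one (by positivity)]
    exact_mod_cast mstd_le n
  · have ht : Filter.Tendsto (fun n : ℕ => ((3 : ℝ) / 4) ^ (n / 2 - 50)) Filter.atTop (nhds 0) := by
      refine (tendsto_pow_atTop_nhds_zero_of_lt_one (by norm_num) (by norm_num)).comp ?_
      refine Filter.tendsto_atTop.2 fun b => ?_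
      filter_upwards [Filter.eventually_ge_atTop (2 * b + 200)] with n hn
      omega
    have he := ht.eventually (gt_mem_nhds (show (0 : ℝ) < 1 / 1000 by norm_num))
    filter_upwards [he, Filter.eventually_ge_atTop 200] with n h1 hn
    have hc : n = (mid n).card + 22 := by
      simp only [mid, Int.card_Icc]; omega
    have a1 : (2 : ℝ) ^ (mid n).card ≤ mstdCount n + (allBad n).card := by
      exact_mod_cast mstd_lower hn
    have a2 := allBad_card hn
    have hp : (0 : ℝ) < 2 ^ (mid n).card := by positivity
    have hpow : (2 : ℝ) ^ n = 2 ^ (mid n).card * 2 ^ 22 := by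
      rw [← pow_add, ← hc]
    have a3 : (2 : ℝ) ^ (mid n).card * (24 / 256 + 22 * (3 / 4) ^ (n / 2 - 50)) ≤
        2 ^ (mid n).card * (24 / 256 + 22 * (1 / 1000)) := by gcongr
    rw [le_div_iff₀ (by positivity), hpow]
    nlinarith
end

section
/- There is a constant C > 0 such that for all sufficiently large n, the number of subsets A ⊆ {0,1,…,n−1} with |A+A+A+A| > |A+A−A−A| is at least C·2^n/n^r, where r = (1/6)·log₂(256/255) ≤ 0.001; that is, the density among all subsets of {0,…,n−1} of sets A satisfying |A+A+A+A| > |(A+A)−(A+A)| is at least C/n^r. -/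
open Finset Filter
open scoped Pointwise

/-- The number of subsets `A ⊆ {0, 1, …, n-1}` with `|A+A+A+A| > |A+A-A-A|`. -/
noncomputable def genMstdCount (n : ℕ) : ℕ :=
  ((Finset.Icc (0 : ℤ) ((n : ℤ) - 1)).powerset.filter
    fun A => (A + A - A - A).card < (A + A + A + A).card).card

/-- Counting sets avoiding a family of disjoint pairs `{i, k - i}`. -/
lemma pair_count (k : ℤ) (P : Finset ℤ) : ∀ S : Finset ℤ,
    (∀ i ∈ P, i ∈ S ∧ k - i ∈ S ∧ i < k - i) →
    4 ^ P.card * (S.powerset.filter (fun M => ∀ i ∈ P, ¬ (i ∈ M ∧ k - i ∈ M))).card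
      ≤ 3 ^ P.card * 2 ^ S.card := by
  induction P using Finset.induction_on with
  | empty => intro S _; simp
  | insert a P ha ih =>
    intro S hS
    obtain ⟨ha1, ha2, ha3⟩ := hS a (by simp)
    set S' : Finset ℤ := (S.erase a).erase (k - a) with hS'
    have hcard : S.card = S'.card + 2 := by
      have h1 : (S.erase a).card + 1 = S.card := Finset.card_erase_add_one ha1
      have h2 : S'.card + 1 = (S.erase a).card :=
        Finset.card_erase_add_one (by
          rw [Finset.mem_erase]; exact ⟨by omega, ha2⟩)
      omega
    have hI := ih S' (by
      intro i hi
      obtain ⟨h1, h2, h3⟩ := hS i (by simp [hi])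
      have hne : i ≠ a := by rintro rfl; exact ha hi
      refine ⟨?_, ?_, h3⟩
      · simp only [hS', Finset.mem_erase]; exact ⟨by omega, hne, h1⟩
      · simp only [hS', Finset.mem_erase]; exact ⟨by omega, by omega, h2⟩)
    set T : Finset (Bool × Bool) := {(false, false), (false, true), (true, false)} with hT
    have hTc : T.card = 3 := by rw [hT]; decide
    have hle : (S.powerset.filter
          (fun M => ∀ i ∈ insert a P, ¬ (i ∈ M ∧ k - i ∈ M))).card
        ≤ ((S'.powerset.filter (fun M => ∀ i ∈ P, ¬ (i ∈ M ∧ k - i ∈ M))) ×ˢ T).card := by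
      apply Finset.card_le_card_of_injOn
        (fun M => ((M.erase a).erase (k - a), (decide (a ∈ M), decide (k - a ∈ M))))
      · intro M hM
        simp only [Finset.coe_filter, Finset.mem_powerset, Set.mem_ofPred_eq] at hM
        obtain ⟨hMS, hM2⟩ := hM
        have h0 := hM2 a (by simp)
        simp only [Finset.coe_product, Set.mem_prod, Finset.mem_coe, Finset.mem_filter,
          Finset.mem_powerset]
        refine ⟨⟨?_, ?_⟩, ?_⟩
        · exact Finset.erase_subset_erase _ (Finset.erase_subset_erase _ hMS)
        · intro i hi hc
          apply hM2 i (by simp [hi])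
          simp only [Finset.mem_erase] at hc
          exact ⟨hc.1.2.2, hc.2.2.2⟩
        · rw [hT]
          by_cases h1 : a ∈ M <;> by_cases h2 : k - a ∈ M <;> simp_all
      · intro M _ M' _ h
        simp only [Prod.mk.injEq, decide_eq_decide] at h
        obtain ⟨h1, h2, h3⟩ := h
        ext x
        by_cases hx : x = a
        · subst hx; exact h2
        by_cases hx' : x = k - a
        · subst hx'; exact h3
        have := Finset.ext_iff.1 h1 x
        simpa [Finset.mem_erase, hx, hx'] using this
    rw [Finset.card_product, hTc] at hle
    rw [Finset.card_insert_of_notMem ha, hcard]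
    calc _ ≤ 4 ^ (P.card + 1) * ((S'.powerset.filter
            (fun M => ∀ i ∈ P, ¬ (i ∈ M ∧ k - i ∈ M))).card * 3) :=
          Nat.mul_le_mul_left _ hle
      _ = 12 * (4 ^ P.card * (S'.powerset.filter
            (fun M => ∀ i ∈ P, ¬ (i ∈ M ∧ k - i ∈ M))).card) := by ring
      _ ≤ 12 * (3 ^ P.card * 2 ^ S'.card) := Nat.mul_le_mul_left _ hI
      _ = _ := by ring

/-- Left fringe. -/
noncomputable def Lf : Finset ℤ := {0, 1, 3, 4, 5, 9} ∪ Finset.Icc 32 63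

/-- Right fringe (reflected). -/
noncomputable def Rf : Finset ℤ := {0, 1, 2, 4, 5, 6, 10} ∪ Finset.Icc 32 63

/-- The full set: left fringe, middle, reflected right fringe. -/
noncomputable def fullSet (N : ℤ) (M : Finset ℤ) : Finset ℤ := Lf ∪ M ∪ Rf.image (fun x => N - x)

lemma run_four (S : Finset ℤ) (h0 : (0 : ℤ) ∈ S) (hr : ∀ x, 32 ≤ x → x ≤ 63 → x ∈ S)
    (k : ℤ) (h1 : 32 ≤ k) (h2 : k ≤ 252) :
    ∃ a ∈ S, ∃ b ∈ S, ∃ c ∈ S, ∃ d ∈ S, a + b + c + d = k := by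
  have h32 := hr 32 (by norm_num) (by norm_num)
  have h63 := hr 63 (by norm_num) (by norm_num)
  by_cases c1 : k ≤ 63
  · exact ⟨k, hr k h1 c1, 0, h0, 0, h0, 0, h0, by ring⟩
  by_cases c2 : k ≤ 95
  · exact ⟨k - 32, hr _ (by omega) (by omega), 32, h32, 0, h0, 0, h0, by ring⟩
  by_cases c3 : k ≤ 126
  · exact ⟨k - 63, hr _ (by omega) (by omega), 63, h63, 0, h0, 0, h0, by ring⟩
  by_cases c4 : k ≤ 158
  · exact ⟨k - 95, hr _ (by omega) (by omega), 63, h63, 32, h32, 0, h0, by ring⟩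
  by_cases c5 : k ≤ 189
  · exact ⟨k - 126, hr _ (by omega) (by omega), 63, h63, 63, h63, 0, h0, by ring⟩
  by_cases c6 : k ≤ 221
  · exact ⟨k - 158, hr _ (by omega) (by omega), 63, h63, 63, h63, 32, h32, by ring⟩
  · exact ⟨k - 189, hr _ (by omega) (by omega), 63, h63, 63, h63, 63, h63, by ring⟩

lemma small_L : ∀ k ∈ (Finset.Icc (0 : ℤ) 31).erase 29,
    ∃ a ∈ ({0, 1, 3, 4, 5, 9} : Finset ℤ), ∃ b ∈ ({0, 1, 3, 4, 5, 9} : Finset ℤ),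
    ∃ c ∈ ({0, 1, 3, 4, 5, 9} : Finset ℤ), ∃ d ∈ ({0, 1, 3, 4, 5, 9} : Finset ℤ),
      a + b + c + d = k := by
  decide +kernel

lemma small_R : ∀ k ∈ (Finset.Icc (0 : ℤ) 31),
    ∃ a ∈ ({0, 1, 2, 4, 5, 6, 10} : Finset ℤ), ∃ b ∈ ({0, 1, 2, 4, 5, 6, 10} : Finset ℤ),
    ∃ c ∈ ({0, 1, 2, 4, 5, 6, 10} : Finset ℤ), ∃ d ∈ ({0, 1, 2, 4, 5, 6, 10} : Finset ℤ),
      a + b + c + d = k := by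
  decide +kernel

lemma small_D : ∀ a ∈ ({0, 1, 3, 4, 5, 9} : Finset ℤ), ∀ b ∈ ({0, 1, 3, 4, 5, 9} : Finset ℤ),
    ∀ c ∈ ({0, 1, 2, 4, 5, 6, 10} : Finset ℤ), ∀ d ∈ ({0, 1, 2, 4, 5, 6, 10} : Finset ℤ),
      a + b + c + d ≠ 31 := by
  decide +kernel

lemma four_L (k : ℤ) (h0 : 0 ≤ k) (h1 : k ≤ 252) (h2 : k ≠ 29) :
    ∃ a ∈ Lf, ∃ b ∈ Lf, ∃ c ∈ Lf, ∃ d ∈ Lf, a + b + c + d = k := by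
  by_cases hk : k ≤ 31
  · obtain ⟨a, ha, b, hb, c, hc, d, hd, h⟩ := small_L k (by simp [h2]; omega)
    exact ⟨a, mem_union_left _ ha, b, mem_union_left _ hb, c, mem_union_left _ hc,
      d, mem_union_left _ hd, h⟩
  · exact run_four Lf (by simp [Lf]) (fun x hx hx' => mem_union_right _ (by simp [hx, hx'])) k
      (by omega) h1

lemma four_R (k : ℤ) (h0 : 0 ≤ k) (h1 : k ≤ 252) :
    ∃ a ∈ Rf, ∃ b ∈ Rf, ∃ c ∈ Rf, ∃ d ∈ Rf, a + b + c + d = k := by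
  by_cases hk : k ≤ 31
  · obtain ⟨a, ha, b, hb, c, hc, d, hd, h⟩ := small_R k (by simp; omega)
    exact ⟨a, mem_union_left _ ha, b, mem_union_left _ hb, c, mem_union_left _ hc,
      d, mem_union_left _ hd, h⟩
  · exact run_four Rf (by simp [Rf]) (fun x hx hx' => mem_union_right _ (by simp [hx, hx'])) k
      (by omega) h1

lemma Lf_bd {x : ℤ} (h : x ∈ Lf) : 0 ≤ x ∧ x ≤ 63 := by
  simp [Lf] at h; omega

lemma Rf_bd {x : ℤ} (h : x ∈ Rf) : 0 ≤ x ∧ x ≤ 63 := by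
  simp [Rf] at h; omega

lemma mem_full_s12 {N x : ℤ} {M : Finset ℤ} :
    x ∈ fullSet N M ↔ x ∈ Lf ∨ x ∈ M ∨ N - x ∈ Rf := by
  simp only [fullSet, mem_union, mem_image, or_assoc]
  constructor
  · rintro (h | h | ⟨y, hy, rfl⟩)
    · exact Or.inl h
    · exact Or.inr (Or.inl h)
    · right; right; simpa using hy
  · rintro (h | h | h)
    · exact Or.inl h
    · exact Or.inr (Or.inl h)
    · exact Or.inr (Or.inr ⟨N - x, h, by ring⟩)

lemma full_bd {N x : ℤ} {M : Finset ℤ} (hN : 1000 ≤ N) (hM : M ⊆ Finset.Icc 64 (N - 64))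
    (h : x ∈ fullSet N M) : 0 ≤ x ∧ x ≤ N := by
  rcases mem_full_s12.1 h with h | h | h
  · have := Lf_bd h; omega
  · have := Finset.mem_Icc.1 (hM h); omega
  · have := Rf_bd h; omega

lemma full_low {N x : ℤ} {M : Finset ℤ} (hN : 1000 ≤ N) (hM : M ⊆ Finset.Icc 64 (N - 64))
    (h : x ∈ fullSet N M) (hx : x ≤ 31) : x ∈ ({0, 1, 3, 4, 5, 9} : Finset ℤ) := by
  rcases mem_full_s12.1 h with h | h | h
  · rcases mem_union.1 h with h | h
    · exact h
    · have := Finset.mem_Icc.1 h; omega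
  · have := Finset.mem_Icc.1 (hM h); omega
  · have := Rf_bd h; omega

lemma full_high {N x : ℤ} {M : Finset ℤ} (hN : 1000 ≤ N) (hM : M ⊆ Finset.Icc 64 (N - 64))
    (h : x ∈ fullSet N M) (hx : N - x ≤ 31) :
    N - x ∈ ({0, 1, 2, 4, 5, 6, 10} : Finset ℤ) := by
  rcases mem_full_s12.1 h with h | h | h
  · have := Lf_bd h; omega
  · have := Finset.mem_Icc.1 (hM h); omega
  · rcases mem_union.1 h with h | h
    · exact h
    · have := Finset.mem_Icc.1 h; omega

lemma diff_ne {N a b c d : ℤ} {M : Finset ℤ} (hN : 1000 ≤ N)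
    (hM : M ⊆ Finset.Icc 64 (N - 64)) (ha : a ∈ fullSet N M) (hb : b ∈ fullSet N M)
    (hc : c ∈ fullSet N M) (hd : d ∈ fullSet N M) : a + b - c - d ≠ 2 * N - 31 := by
  intro h
  have ha' := full_bd hN hM ha
  have hb' := full_bd hN hM hb
  have hc' := full_bd hN hM hc
  have hd' := full_bd hN hM hd
  exact small_D c (full_low hN hM hc (by omega)) d (full_low hN hM hd (by omega))
    (N - a) (full_high hN hM ha (by omega)) (N - b) (full_high hN hM hb (by omega)) (by omega)

lemma diff_card {N : ℤ} {M : Finset ℤ} (hN : 1000 ≤ N) (hM : M ⊆ Finset.Icc 64 (N - 64)) :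
    ((fullSet N M + fullSet N M - fullSet N M - fullSet N M).card : ℤ) ≤ 4 * N - 1 := by
  have hsub : fullSet N M + fullSet N M - fullSet N M - fullSet N M ⊆
      ((Finset.Icc (-(2 * N)) (2 * N)).erase (2 * N - 31)).erase (-(2 * N - 31)) := by
    intro x hx
    obtain ⟨y, hy, d, hd, rfl⟩ := Finset.mem_sub.1 hx
    obtain ⟨z, hz, c, hc, rfl⟩ := Finset.mem_sub.1 hy
    obtain ⟨a, ha, b, hb, rfl⟩ := Finset.mem_add.1 hz
    have ha' := full_bd hN hM ha
    have hb' := full_bd hN hM hb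
    have hc' := full_bd hN hM hc
    have hd' := full_bd hN hM hd
    have h1 := diff_ne hN hM ha hb hc hd
    have h2 := diff_ne hN hM hc hd ha hb
    simp only [Finset.mem_erase, Finset.mem_Icc]
    refine ⟨by omega, by omega, by omega, by omega⟩
  have h := Finset.card_le_card hsub
  have h1 := Finset.card_erase_add_one (s := Finset.Icc (-(2 * N)) (2 * N)) (a := 2 * N - 31)
    (by rw [Finset.mem_Icc]; omega)
  have h2 := Finset.card_erase_add_one
    (s := (Finset.Icc (-(2 * N)) (2 * N)).erase (2 * N - 31)) (a := -(2 * N - 31))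
    (by rw [Finset.mem_erase, Finset.mem_Icc]; omega)
  rw [Int.card_Icc] at h1
  omega

lemma sum_card {N : ℤ} {M : Finset ℤ} (hN : 1000 ≤ N)
    (h : ∀ k, 253 ≤ k → k ≤ 2 * N - 253 → ∃ i ∈ M, k - i ∈ M) :
    4 * N ≤ ((fullSet N M + fullSet N M + fullSet N M + fullSet N M).card : ℤ) := by
  have h0 : (0 : ℤ) ∈ fullSet N M := mem_full_s12.2 (Or.inl (by simp [Lf]))
  have hNm : N ∈ fullSet N M := mem_full_s12.2 (Or.inr (Or.inr (by simp [Rf])))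
  have hMm : ∀ x ∈ M, x ∈ fullSet N M := fun x hx => mem_full_s12.2 (Or.inr (Or.inl hx))
  have hsub : (Finset.Icc 0 (4 * N)).erase 29 ⊆
      fullSet N M + fullSet N M + fullSet N M + fullSet N M := by
    intro k hk
    simp only [Finset.mem_erase, Finset.mem_Icc] at hk
    obtain ⟨hk29, hk0, hk4⟩ := hk
    suffices hs : ∃ a ∈ fullSet N M, ∃ b ∈ fullSet N M, ∃ c ∈ fullSet N M, ∃ d ∈ fullSet N M,
        a + b + c + d = k by
      obtain ⟨a, ha, b, hb, c, hc, d, hd, rfl⟩ := hs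
      exact add_mem_add (add_mem_add (add_mem_add ha hb) hc) hd
    by_cases c1 : k ≤ 252
    · obtain ⟨a, ha, b, hb, c, hc, d, hd, he⟩ := four_L k hk0 c1 hk29
      exact ⟨a, mem_full_s12.2 (Or.inl ha), b, mem_full_s12.2 (Or.inl hb), c, mem_full_s12.2 (Or.inl hc),
        d, mem_full_s12.2 (Or.inl hd), he⟩
    by_cases c2 : k ≤ 2 * N - 253
    · obtain ⟨i, hi, hi'⟩ := h k (by omega) c2
      exact ⟨i, hMm _ hi, _, hMm _ hi', 0, h0, 0, h0, by ring⟩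
    by_cases c3 : k ≤ 3 * N - 253
    · obtain ⟨i, hi, hi'⟩ := h (k - N) (by omega) (by omega)
      exact ⟨i, hMm _ hi, _, hMm _ hi', N, hNm, 0, h0, by ring⟩
    by_cases c4 : k ≤ 4 * N - 253
    · obtain ⟨i, hi, hi'⟩ := h (k - 2 * N) (by omega) (by omega)
      exact ⟨i, hMm _ hi, _, hMm _ hi', N, hNm, N, hNm, by ring⟩
    · obtain ⟨a, ha, b, hb, c, hc, d, hd, he⟩ := four_R (4 * N - k) (by omega) (by omega)
      have hR : ∀ x ∈ Rf, N - x ∈ fullSet N M := fun x hx =>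
        mem_full_s12.2 (Or.inr (Or.inr (by simpa using hx)))
      exact ⟨_, hR a ha, _, hR b hb, _, hR c hc, _, hR d hd, by omega⟩
  have hc := Finset.card_le_card hsub
  have h1 := Finset.card_erase_add_one (s := Finset.Icc 0 (4 * N)) (a := 29)
    (by rw [Finset.mem_Icc]; omega)
  rw [Int.card_Icc] at h1
  omega

/-- Bad event for a single `k` on the middle. -/
lemma bad_one (N k : ℤ) (j : ℕ) (hj : 253 ≤ j) (hjN : (j : ℤ) ≤ N)
    (hk : k = j ∨ k = 2 * N - j) :
    (((Finset.Icc 64 (N - 64)).powerset.filter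
      (fun M => ¬ ∃ i ∈ M, k - i ∈ M)).card : ℝ)
      ≤ (7 / 8 : ℝ) ^ (j - 129) * 2 ^ (Finset.Icc 64 (N - 64)).card := by
  obtain ⟨p, hp1, hp2, P, hPc, hP⟩ : ∃ p : ℕ, j - 129 ≤ 2 * p ∧ True ∧ ∃ P : Finset ℤ,
      P.card = p ∧ ∀ i ∈ P, i ∈ Finset.Icc 64 (N - 64) ∧ k - i ∈ Finset.Icc 64 (N - 64)
        ∧ i < k - i := by
    rcases hk with hk | hk
    · refine ⟨((k - 1) / 2 + 1 - 64).toNat, by omega, trivial, Finset.Icc 64 ((k - 1) / 2),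
        Int.card_Icc _ _, ?_⟩
      intro i hi
      simp only [Finset.mem_Icc] at hi ⊢
      omega
    · refine ⟨((k - 1) / 2 + 1 - (k - N + 64)).toNat, by omega, trivial,
        Finset.Icc (k - N + 64) ((k - 1) / 2), Int.card_Icc _ _, ?_⟩
      intro i hi
      simp only [Finset.mem_Icc] at hi ⊢
      omega
  have hc := pair_count k P _ hP
  have hle : ((Finset.Icc 64 (N - 64)).powerset.filter
      (fun M => ¬ ∃ i ∈ M, k - i ∈ M)).card ≤ ((Finset.Icc 64 (N - 64)).powerset.filter
        (fun M => ∀ i ∈ P, ¬ (i ∈ M ∧ k - i ∈ M))).card := by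
    apply Finset.card_le_card
    intro M hM
    simp only [Finset.mem_filter] at hM ⊢
    exact ⟨hM.1, fun i _ hi => hM.2 ⟨i, hi.1, hi.2⟩⟩
  rw [hPc] at hc
  generalize ((Finset.Icc 64 (N - 64)).powerset.filter
        (fun M => ∀ i ∈ P, ¬ (i ∈ M ∧ k - i ∈ M))).card = X at hc hle
  generalize (Finset.Icc 64 (N - 64)).card = s at hc ⊢
  have hc' : (4 : ℝ) ^ p * X ≤ 3 ^ p * 2 ^ s := by exact_mod_cast hc
  have h1 : (X : ℝ) ≤ (3 / 4 : ℝ) ^ p * 2 ^ s := by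
    rw [div_pow, div_mul_eq_mul_div, le_div_iff₀ (by positivity)]
    linarith
  have h2 : (3 / 4 : ℝ) ^ p ≤ (7 / 8 : ℝ) ^ (j - 129) := by
    calc (3 / 4 : ℝ) ^ p ≤ ((7 / 8 : ℝ) ^ 2) ^ p := by gcongr; norm_num
      _ = (7 / 8 : ℝ) ^ (2 * p) := by rw [pow_mul]
      _ ≤ _ := pow_le_pow_of_le_one (by norm_num) (by norm_num) hp1
  calc _ ≤ (X : ℝ) := by exact_mod_cast hle
    _ ≤ _ := h1
    _ ≤ _ := by gcongr

lemma geom_bound (m : ℕ) :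
    ∑ j ∈ Finset.Icc 253 m, 2 * (7 / 8 : ℝ) ^ (j - 129) ≤ 1 / 2 := by
  have key : ∀ m : ℕ, ∑ j ∈ Finset.range m, (7 / 8 : ℝ) ^ j ≤ 8 := by
    intro m
    rw [geom_sum_eq (by norm_num)]
    have : (0 : ℝ) < (7 / 8) ^ m := by positivity
    rw [div_le_iff_of_neg (by norm_num)]
    linarith
  have hs : Finset.Icc 253 m ⊆ (Finset.range m).image (fun j => j + 253) := by
    intro x hx
    simp only [Finset.mem_Icc] at hx
    simp only [Finset.mem_image, Finset.mem_range]
    exact ⟨x - 253, by omega, by omega⟩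
  calc _ ≤ ∑ j ∈ (Finset.range m).image (fun j => j + 253), 2 * (7 / 8 : ℝ) ^ (j - 129) :=
        Finset.sum_le_sum_of_subset_of_nonneg hs (fun _ _ _ => by positivity)
    _ = ∑ j ∈ Finset.range m, 2 * (7 / 8 : ℝ) ^ (j + 253 - 129) :=
        Finset.sum_image (fun _ _ _ _ h => by simpa using h)
    _ = ∑ j ∈ Finset.range m, (2 * (7 / 8 : ℝ) ^ 124) * (7 / 8 : ℝ) ^ j := by
        apply Finset.sum_congr rfl
        intro j _
        rw [show j + 253 - 129 = 124 + j by omega, pow_add]; ring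
    _ = (2 * (7 / 8 : ℝ) ^ 124) * ∑ j ∈ Finset.range m, (7 / 8 : ℝ) ^ j := by
        rw [Finset.mul_sum]
    _ ≤ (2 * (7 / 8 : ℝ) ^ 124) * 8 := by gcongr; exact key m
    _ ≤ 1 / 2 := by norm_num

/-- The good middles. -/
noncomputable def goodMid (N : ℤ) : Finset (Finset ℤ) :=
  (Finset.Icc 64 (N - 64)).powerset.filter
    (fun M => ∀ k, 253 ≤ k → k ≤ 2 * N - 253 → ∃ i ∈ M, k - i ∈ M)

set_option maxRecDepth 10000 in
lemma good_count (N : ℕ) (hN : 1000 ≤ N) :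
    (1 / 2 : ℝ) * 2 ^ (N - 127) ≤ ((goodMid N).card : ℝ) := by
  have hs : (Finset.Icc 64 ((N : ℤ) - 64)).card = N - 127 := by
    rw [Int.card_Icc]; omega
  set B : ℤ → Finset (Finset ℤ) := fun k => (Finset.Icc 64 ((N : ℤ) - 64)).powerset.filter
      (fun M => ¬ ∃ i ∈ M, k - i ∈ M) with hB
  have hcov : (Finset.Icc 64 ((N : ℤ) - 64)).powerset ⊆
      goodMid N ∪ (Finset.Icc 253 N).biUnion (fun j => B (j : ℤ) ∪ B (2 * (N : ℤ) - j)) := by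
    intro M hM
    rw [Finset.mem_union]
    refine or_iff_not_imp_left.2 (fun hg => ?_)
    simp only [goodMid, Finset.mem_filter, hM, true_and, not_forall] at hg
    obtain ⟨k, hk1, hk2, hk3⟩ := hg
    rw [Finset.mem_biUnion]
    by_cases hkN : k ≤ N
    · refine ⟨k.toNat, by rw [Finset.mem_Icc]; omega, mem_union_left _ ?_⟩
      have : ((k.toNat : ℕ) : ℤ) = k := by omega
      rw [this, hB]
      exact Finset.mem_filter.2 ⟨hM, hk3⟩
    · refine ⟨(2 * (N : ℤ) - k).toNat, by rw [Finset.mem_Icc]; omega, mem_union_right _ ?_⟩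
      have : 2 * (N : ℤ) - (((2 * (N : ℤ) - k).toNat : ℕ) : ℤ) = k := by omega
      rw [this, hB]
      exact Finset.mem_filter.2 ⟨hM, hk3⟩
  have h1 := (Finset.card_le_card hcov).trans (Finset.card_union_le _ _)
  rw [Finset.card_powerset, hs] at h1
  have h2 : ((((Finset.Icc 253 N).biUnion
      (fun j => B (j : ℤ) ∪ B (2 * (N : ℤ) - j))).card : ℕ) : ℝ) ≤ 1 / 2 * 2 ^ (N - 127) := by
    calc _ ≤ ((∑ j ∈ Finset.Icc 253 N, (B (j : ℤ) ∪ B (2 * (N : ℤ) - j)).card : ℕ) : ℝ) := by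
          exact_mod_cast Finset.card_biUnion_le
      _ ≤ ∑ j ∈ Finset.Icc 253 N, (2 * (7 / 8 : ℝ) ^ (j - 129)) * 2 ^ (N - 127) := by
          push_cast
          apply Finset.sum_le_sum
          intro j hj
          rw [Finset.mem_Icc] at hj
          have e1 := bad_one N j j hj.1 (by exact_mod_cast hj.2) (Or.inl rfl)
          have e2 := bad_one N (2 * N - j) j hj.1 (by exact_mod_cast hj.2) (Or.inr rfl)
          rw [hs] at e1 e2
          have e3 : ((B (j : ℤ) ∪ B (2 * (N : ℤ) - j)).card : ℝ)
              ≤ (B (j : ℤ)).card + (B (2 * (N : ℤ) - j)).card := by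
            exact_mod_cast Finset.card_union_le _ _
          simp only [hB] at e3 ⊢
          linarith
      _ ≤ _ := by
          rw [← Finset.sum_mul]
          gcongr
          exact geom_bound N
  have h3 : (2 : ℝ) ^ (N - 127) ≤ ((goodMid N).card : ℝ) + (((Finset.Icc 253 N).biUnion
      (fun j => B (j : ℤ) ∪ B (2 * (N : ℤ) - j))).card : ℝ) := by exact_mod_cast h1
  linarith

lemma good_le (n : ℕ) (hn : 1001 ≤ n) : (goodMid ((n : ℤ) - 1)).card ≤ genMstdCount n := by
  have hN : (1000 : ℤ) ≤ (n : ℤ) - 1 := by omega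
  unfold genMstdCount
  apply Finset.card_le_card_of_injOn (fun M => fullSet ((n : ℤ) - 1) M)
  · intro M hM
    have hM' := Finset.mem_filter.1 (Finset.mem_coe.1 hM)
    have hMs := Finset.mem_powerset.1 hM'.1
    rw [Finset.mem_coe, Finset.mem_filter, Finset.mem_powerset]
    constructor
    · intro x hx
      exact Finset.mem_Icc.2 (full_bd hN hMs hx)
    · have h1 := diff_card hN hMs
      have h2 := sum_card hN hM'.2
      have h3 := Int.lt_of_le_of_lt h1 (Int.lt_of_lt_of_le (by omega) h2)
      exact_mod_cast h3
  · have aux : ∀ M ∈ goodMid ((n : ℤ) - 1), ∀ x, x ∈ M ↔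
        x ∈ fullSet ((n : ℤ) - 1) M ∧ 64 ≤ x ∧ x ≤ (n : ℤ) - 1 - 64 := by
      intro M hM x
      have hMs := Finset.mem_powerset.1 (Finset.mem_filter.1 hM).1
      constructor
      · intro hx
        have := Finset.mem_Icc.1 (hMs hx)
        exact ⟨mem_full_s12.2 (Or.inr (Or.inl hx)), this.1, this.2⟩
      · rintro ⟨hx, h1, h2⟩
        rcases mem_full_s12.1 hx with h | h | h
        · have := Lf_bd h; omega
        · exact h
        · have := Rf_bd h; omega
    intro M hM M' hM' h
    ext x
    rw [aux M hM, aux M' hM']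
    simp only at h
    rw [h]

/-- Miller–Pegado–Robinson: there is a constant `C > 0` such that for all sufficiently
large `n`, the number of subsets `A ⊆ {0,…,n-1}` with `|A+A+A+A| > |A+A-A-A|` is at
least `C·2^n/n^r`, where `r = (1/6)·log₂(256/255)`. -/
theorem four_fold_mstd_density_lower_bound :
    ∃ C : ℝ, 0 < C ∧ ∃ N : ℕ, ∀ n : ℕ, N ≤ n →
      C * 2 ^ n / (n : ℝ) ^ ((1 / 6 : ℝ) * Real.logb 2 (256 / 255)) ≤
        (genMstdCount n : ℝ) := by
  refine ⟨1 / 2 ^ 129, by positivity, 1001, fun n hn => ?_⟩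
  have h1 : (1 : ℝ) ≤ (n : ℝ) ^ ((1 / 6 : ℝ) * Real.logb 2 (256 / 255)) := by
    apply Real.one_le_rpow
    · exact_mod_cast (by omega : 1 ≤ n)
    · have := Real.logb_nonneg (b := 2) (x := 256 / 255) (by norm_num) (by norm_num)
      positivity
  have h2 := good_count (n - 1) (by omega)
  have h3 : (((n - 1 : ℕ) : ℤ)) = (n : ℤ) - 1 := by omega
  rw [h3] at h2
  have h4 : ((goodMid ((n : ℤ) - 1)).card : ℝ) ≤ genMstdCount n := by
    exact_mod_cast good_le n hn
  have h5 : (2 : ℝ) ^ n = 2 ^ 128 * 2 ^ (n - 1 - 127) := by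
    rw [← pow_add, show 128 + (n - 1 - 127) = n by omega]
  calc _ ≤ 1 / 2 ^ 129 * (2 : ℝ) ^ n := div_le_self (by positivity) h1
    _ = 1 / 2 * 2 ^ (n - 1 - 127) := by rw [h5]; ring
    _ ≤ _ := h2.trans h4
end
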